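/- arXiv:1801.07452 — 2 statements merged into one kernel-verified Lean document; each statement's English description precedes it below -/
import Mathlib

section
/- Let n be a positive integer. Let φ ∈ Γ0(ℝⁿ) be invariant under permutations of coordinates, let y ∈ int(dom φ) be a point at which φ is differentiable with gradient ∇φ(y), and let ψ ∈ Γ0(ℝⁿ) be invariant under permutations of coordinates with int(dom φ) ∩ dom ψ ≠ ∅. Let f and g₀ be the spectral functions on S_n associated with φ and ψ, let U be an n×n orthogonal matrix, and set Y = U Diag(y) Uᵀ and T = U Diag(∇φ(y)) Uᵀ. Assume the function d ↦ φ(d) − dᵀ∇φ(y) + ψ(d) is coercive on ℝⁿ and has a unique minimizer d̂. Then the matrix U Diag(d̂) Uᵀ minimizes over S_n the Bregman-proximal objective C ↦ g₀(C) + f(C) − f(Y) − tr(T(C − Y)) (that is, C ↦ g₀(C) + D^f(C,Y)). -/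
open Matrix Filter Topology Set

noncomputable section

/-- A real matrix is orthogonal. -/
def IsOrth {n : ℕ} (U : Matrix (Fin n) (Fin n) ℝ) : Prop := Uᵀ * U = 1

/-- `d` is a vector of eigenvalues of `C`, i.e. `C = U Diag(d) Uᵀ` for some orthogonal `U`. -/
def IsEigVec {n : ℕ} (C : Matrix (Fin n) (Fin n) ℝ) (d : Fin n → ℝ) : Prop :=
  ∃ U : Matrix (Fin n) (Fin n) ℝ, IsOrth U ∧ C = U * Matrix.diagonal d * Uᵀ

/-- Invariance under permutations of coordinates. -/
def PermInv {n : ℕ} (φ : (Fin n → ℝ) → EReal) : Prop :=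
  ∀ (σ : Equiv.Perm (Fin n)) (d : Fin n → ℝ), φ (d ∘ σ) = φ d

/-- `F` is the spectral function on symmetric matrices associated with `φ`. -/
def IsSpectral {n : ℕ} (F : Matrix (Fin n) (Fin n) ℝ → EReal)
    (φ : (Fin n → ℝ) → EReal) : Prop :=
  PermInv φ ∧ ∀ (C : Matrix (Fin n) (Fin n) ℝ) (d : Fin n → ℝ), IsEigVec C d → F C = φ d

/-- A function with values in (−∞,+∞] (represented in `EReal`, so it never takes the value ⊥)
which is finite somewhere. -/
def IsProper {α : Type*} (φ : α → EReal) : Prop := (∃ x, φ x ≠ ⊤) ∧ ∀ x, φ x ≠ ⊥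

/-- Convexity for extended-real-valued functions. -/
def EConvex {E : Type*} [AddCommGroup E] [Module ℝ E] (φ : E → EReal) : Prop :=
  ∀ (x y : E) (a b : ℝ), 0 ≤ a → 0 ≤ b → a + b = 1 →
    φ (a • x + b • y) ≤ (a : EReal) * φ x + (b : EReal) * φ y

/-- The class Γ₀ : proper, lower semicontinuous, convex functions into (−∞,+∞]. -/
def Gamma0 {E : Type*} [AddCommGroup E] [Module ℝ E] [TopologicalSpace E]
    (φ : E → EReal) : Prop :=
  IsProper φ ∧ LowerSemicontinuous φ ∧ EConvex φ

/-- Squared Frobenius norm. -/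
def frobSq {n : ℕ} (A : Matrix (Fin n) (Fin n) ℝ) : ℝ := ∑ i, ∑ j, (A i j) ^ 2

/-- Frobenius norm. -/
def frobNorm {n : ℕ} (A : Matrix (Fin n) (Fin n) ℝ) : ℝ := Real.sqrt (frobSq A)


/-- The continuous linear functional `x ↦ ∑ i, t i * x i` on `ℝⁿ`. -/
def dotCLM {n : ℕ} (t : Fin n → ℝ) : (Fin n → ℝ) →L[ℝ] ℝ :=
  LinearMap.toContinuousLinearMap
    { toFun := fun x => ∑ i, t i * x i
      map_add' := fun x y => by
        simp [mul_add, Finset.sum_add_distrib]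
      map_smul' := fun c x => by
        simp only [Pi.smul_apply, smul_eq_mul, RingHom.id_apply, Finset.mul_sum]
        exact Finset.sum_congr rfl fun i _ => by ring }

lemma aux_trace {n : ℕ} (U V : Matrix (Fin n) (Fin n) ℝ) (t l : Fin n → ℝ) :
    ((U * Matrix.diagonal t * Uᵀ) * (V * Matrix.diagonal l * Vᵀ)).trace
      = t ⬝ᵥ ((Matrix.of fun i j => ((Uᵀ * V) i j) ^ 2) *ᵥ l) := by
  have h1 : ((U * Matrix.diagonal t * Uᵀ) * (V * Matrix.diagonal l * Vᵀ)).trace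
      = (Matrix.diagonal t * ((Uᵀ * V) * Matrix.diagonal l * (Uᵀ * V)ᵀ)).trace := by
    rw [Matrix.mul_assoc U, Matrix.mul_assoc U, Matrix.trace_mul_comm U]
    simp only [Matrix.transpose_mul, Matrix.transpose_transpose, Matrix.mul_assoc]
  rw [h1]
  generalize Uᵀ * V = W
  simp only [Matrix.trace, Matrix.diag, Matrix.diagonal_mul, dotProduct, Matrix.mulVec]
  refine Finset.sum_congr rfl fun i _ => ?_
  congr 1
  rw [Matrix.mul_apply]
  refine Finset.sum_congr rfl fun j _ => ?_
  simp only [Matrix.mul_diagonal, Matrix.transpose_apply, Matrix.of_apply]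
  ring

lemma aux_birk {n : ℕ} (W : Matrix (Fin n) (Fin n) ℝ) (hW : Wᵀ * W = 1) (t l : Fin n → ℝ) :
    ∃ σ : Equiv.Perm (Fin n),
      t ⬝ᵥ ((Matrix.of fun i j => (W i j) ^ 2) *ᵥ l) ≤ t ⬝ᵥ (l ∘ σ) := by
  have hW' : W * Wᵀ = 1 := mul_eq_one_comm.mp hW
  have hM : (Matrix.of fun i j => (W i j) ^ 2) ∈ doublyStochastic ℝ (Fin n) := by
    rw [mem_doublyStochastic_iff_sum]
    refine ⟨fun i j => sq_nonneg _, fun i => ?_, fun j => ?_⟩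
    · have := congrFun (congrFun hW' i) i
      simpa [Matrix.mul_apply, sq] using this
    · have := congrFun (congrFun hW j) j
      simpa [Matrix.mul_apply, sq] using this
  let L : Matrix (Fin n) (Fin n) ℝ →ₗ[ℝ] ℝ :=
    { toFun := fun M => t ⬝ᵥ (M *ᵥ l)
      map_add' := fun A B => by simp [Matrix.add_mulVec]
      map_smul' := fun c A => by simp [Matrix.smul_mulVec] }
  rw [← SetLike.mem_coe, doublyStochastic_eq_convexHull_permMatrix] at hM
  obtain ⟨_, ⟨σ, rfl⟩, hσ⟩ :=
    (L.convexOn convex_univ).exists_ge_of_mem_convexHull (Set.subset_univ _) hM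
  refine ⟨σ, hσ.trans (le_of_eq ?_)⟩
  change t ⬝ᵥ (σ.permMatrix ℝ *ᵥ l) = _
  rw [Matrix.permMatrix_mulVec]

lemma aux_eig {n : ℕ} (C : Matrix (Fin n) (Fin n) ℝ) (hC : C.IsSymm) :
    ∃ l, IsEigVec C l := by
  have hA : C.IsHermitian := by
    rw [Matrix.IsHermitian, Matrix.conjTranspose_eq_transpose_of_trivial]; exact hC
  refine ⟨hA.eigenvalues, hA.eigenvectorUnitary, ?_, ?_⟩
  · have := (Matrix.mem_unitaryGroup_iff'.1 hA.eigenvectorUnitary.2)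
    rwa [Matrix.star_eq_conjTranspose, Matrix.conjTranspose_eq_transpose_of_trivial] at this
  · have := hA.spectral_theorem
    rw [Unitary.conjStarAlgAut_apply] at this
    rw [Matrix.star_eq_conjTranspose, Matrix.conjTranspose_eq_transpose_of_trivial] at this
    exact this

lemma aux_ereal (a b a' b' : EReal) (c s s' r r' u : ℝ) (ha : a ≠ ⊥) (hb : b ≠ ⊥)
    (ha' : a' ≠ ⊥) (hb' : b' ≠ ⊥)
    (h : a - (s : EReal) + b ≤ a' - (s' : EReal) + b') (hr : r = s - u) (hr' : r' ≤ s' - u) :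
    b + a - (c : EReal) - (r : EReal) ≤ b' + a' - (c : EReal) - (r' : EReal) := by
  have key : b' = ⊤ ∨ a' = ⊤ → b' + a' - (c : EReal) - (r' : EReal) = ⊤ := by
    rintro (rfl | rfl)
    · rw [EReal.top_add_of_ne_bot ha', EReal.top_sub_coe, EReal.top_sub_coe]
    · rw [EReal.add_top_of_ne_bot hb', EReal.top_sub_coe, EReal.top_sub_coe]
  by_cases h1 : b' = ⊤ ∨ a' = ⊤
  · rw [key h1]; exact le_top
  push Not at h1
  lift a' to ℝ using ⟨h1.2, ha'⟩
  lift b' to ℝ using ⟨h1.1, hb'⟩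
  have hat : a ≠ ⊤ := by
    rintro rfl
    rw [EReal.top_sub_coe, EReal.top_add_of_ne_bot hb, top_le_iff] at h
    exact absurd h (by norm_cast; exact EReal.coe_ne_top _)
  lift a to ℝ using ⟨hat, ha⟩
  have hbt : b ≠ ⊤ := by
    rintro rfl
    rw [← EReal.coe_sub, EReal.coe_add_top, top_le_iff] at h
    exact absurd h (by norm_cast; exact EReal.coe_ne_top _)
  lift b to ℝ using ⟨hbt, hb⟩
  norm_cast at h ⊢
  linarith

/-- Corollary 1 of the paper. Let `φ, ψ ∈ Γ₀(ℝⁿ)` be permutation invariant, `f`,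
`g₀` the associated spectral functions, `y ∈ int dom φ` a point where `φ` is differentiable with
gradient `t = ∇φ(y)`, `int dom φ ∩ dom ψ ≠ ∅`, `U` orthogonal, `Y = U Diag(y) Uᵀ`,
`T = U Diag(t) Uᵀ`. If `d ↦ φ(d) − dᵀt + ψ(d)` is coercive with unique minimizer `d̂`, then
`U Diag(d̂) Uᵀ` minimizes `C ↦ g₀(C) + f(C) − f(Y) − tr(T(C − Y))` over symmetric matrices. -/
theorem stmt3 (n : ℕ) (hn : 0 < n)
    (φ ψ : (Fin n → ℝ) → EReal) (hφ : Gamma0 φ) (hψ : Gamma0 ψ)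
    (f g₀ : Matrix (Fin n) (Fin n) ℝ → EReal)
    (hf : IsSpectral f φ) (hg : IsSpectral g₀ ψ)
    (y : Fin n → ℝ) (hy : y ∈ interior {x : Fin n → ℝ | φ x ≠ ⊤})
    (t : Fin n → ℝ) (hgrad : HasFDerivAt (fun x => (φ x).toReal) (dotCLM t) y)
    (hdom : ∃ x : Fin n → ℝ, x ∈ interior {x : Fin n → ℝ | φ x ≠ ⊤} ∧ ψ x ≠ ⊤)
    (U : Matrix (Fin n) (Fin n) ℝ) (hU : IsOrth U)
    (hcoer : ∀ M : ℝ, ∃ R : ℝ, ∀ d : Fin n → ℝ, R ≤ ‖d‖ →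
      (M : EReal) ≤ φ d - ((∑ i, d i * t i : ℝ) : EReal) + ψ d)
    (dhat : Fin n → ℝ)
    (hmin : ∀ d : Fin n → ℝ,
      φ dhat - ((∑ i, dhat i * t i : ℝ) : EReal) + ψ dhat
        ≤ φ d - ((∑ i, d i * t i : ℝ) : EReal) + ψ d)
    (huniq : ∀ d : Fin n → ℝ,
      (∀ d' : Fin n → ℝ,
        φ d - ((∑ i, d i * t i : ℝ) : EReal) + ψ d
          ≤ φ d' - ((∑ i, d' i * t i : ℝ) : EReal) + ψ d') → d = dhat) :
    ∀ C : Matrix (Fin n) (Fin n) ℝ, C.IsSymm →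
      g₀ (U * Matrix.diagonal dhat * Uᵀ) + f (U * Matrix.diagonal dhat * Uᵀ)
          - f (U * Matrix.diagonal y * Uᵀ)
          - ((((U * Matrix.diagonal t * Uᵀ) *
              (U * Matrix.diagonal dhat * Uᵀ - U * Matrix.diagonal y * Uᵀ)).trace : ℝ) : EReal)
        ≤ g₀ C + f C - f (U * Matrix.diagonal y * Uᵀ)
          - ((((U * Matrix.diagonal t * Uᵀ) *
              (C - U * Matrix.diagonal y * Uᵀ)).trace : ℝ) : EReal) := by
  intro C hC
  obtain ⟨l, V, hV, hCV⟩ := aux_eig C hC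
  have hUU : U * Uᵀ = 1 := mul_eq_one_comm.mp hU
  have hW : (Uᵀ * V)ᵀ * (Uᵀ * V) = 1 := by
    rw [Matrix.transpose_mul, Matrix.transpose_transpose, Matrix.mul_assoc,
      ← Matrix.mul_assoc U, hUU, Matrix.one_mul]
    exact hV
  obtain ⟨σ, hσ⟩ := aux_birk (Uᵀ * V) hW t l
  rw [hf.2 _ dhat ⟨U, hU, rfl⟩, hg.2 _ dhat ⟨U, hU, rfl⟩, hf.2 _ y ⟨U, hU, rfl⟩,
    hf.2 C l ⟨V, hV, hCV⟩, hg.2 C l ⟨V, hV, hCV⟩, ← hf.1 σ l, ← hg.1 σ l]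
  have hyt : φ y ≠ ⊤ := interior_subset hy
  have hyc : φ y = ((φ y).toReal : EReal) := (EReal.coe_toReal hyt (hφ.1.2 y)).symm
  rw [hyc]
  refine aux_ereal _ _ _ _ _ _ _ _ _
    (((U * Matrix.diagonal t * Uᵀ) * (U * Matrix.diagonal y * Uᵀ)).trace)
    (hφ.1.2 _) (hψ.1.2 _) (hφ.1.2 _) (hψ.1.2 _) (hmin (l ∘ σ)) ?_ ?_
  · rw [Matrix.mul_sub, Matrix.trace_sub]
    congr 1
    rw [aux_trace, show Uᵀ * U = 1 from hU]
    have : (Matrix.of fun i j => ((1 : Matrix (Fin n) (Fin n) ℝ) i j) ^ 2) = 1 := by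
      ext i j
      by_cases hij : i = j <;> simp [Matrix.one_apply, hij]
    rw [this, Matrix.one_mulVec, dotProduct_comm]
    rfl
  · rw [Matrix.mul_sub, Matrix.trace_sub]
    refine sub_le_sub_right ?_ _
    rw [hCV, aux_trace]
    refine hσ.trans (le_of_eq ?_)
    rw [dotProduct_comm]
    rfl
end
end

section
/- Let n be a positive integer, γ > 0, and let C̄, T ∈ S_n. Let f and g₀ be the spectral functions on S_n associated with φ ∈ Γ0(ℝⁿ) and ψ ∈ Γ0(ℝⁿ). Assume that for every λ' = (λ'₁,…,λ'ₙ) ∈ ℝⁿ one has φ(λ') + ψ(λ') = Σᵢ ρᵢ(λ'ᵢ), where each ρᵢ : ℝ → (−∞,+∞] belongs to Γ0(ℝ) and satisfies dom ρᵢ ∩ [0,+∞) ≠ ∅. Let λ = (λ₁,…,λₙ) ∈ ℝⁿ and let U be an orthogonal matrix with C̄ + γT = U Diag(λ) Uᵀ. Then the function C ↦ γ(f(C) − tr(TC) + g₀(C)) + ½‖C − C̄‖_F², restricted by the constraint that C be positive semidefinite (the objective being +∞ otherwise), has the unique minimizer U Diag((max(0, prox_{γρᵢ}(λᵢ)))₁≤ᵢ≤ₙ)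 Uᵀ, where prox_{γρᵢ}(λᵢ) is the unique minimizer over ℝ of x ↦ γρᵢ(x) + ½(x − λᵢ)². -/
open Matrix Filter Topology Set

noncomputable section

open scoped Classical

lemma aux_sum_top {ι : Type*} (s : Finset ι) (a : ι → EReal) (h : ∀ i, a i ≠ ⊥) :
    (∑ i ∈ s, a i) ≠ ⊥ ∧ ((∑ i ∈ s, a i) = ⊤ ↔ ∃ i ∈ s, a i = ⊤) := by
  induction s using Finset.induction_on with
  | empty => simp
  | insert i s hi ih =>
    rw [Finset.sum_insert hi]
    refine ⟨?_, ?_⟩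
    · rw [Ne, EReal.add_eq_bot_iff]
      exact fun h' => h'.elim (h i) ih.1
    · have e : a i + ∑ k ∈ s, a k = ⊤ ↔ a i = ⊤ ∨ ∑ k ∈ s, a k = ⊤ := by
        constructor
        · intro h1
          by_contra hcon
          push Not at hcon
          exact (EReal.add_lt_top hcon.1 hcon.2).ne h1
        · rintro (h1 | h1)
          · rw [h1, EReal.top_add_of_ne_bot ih.1]
          · rw [h1, EReal.add_top_of_ne_bot (h i)]
      rw [e, ih.2]
      simp

lemma aux_sum_coe {ι : Type*} (s : Finset ι) (a : ι → EReal) (h : ∀ i, a i ≠ ⊥)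
    (h' : ∀ i, a i ≠ ⊤) : (∑ i ∈ s, a i) = ((∑ i ∈ s, (a i).toReal : ℝ) : EReal) := by
  induction s using Finset.induction_on with
  | empty => simp
  | insert i s hi ih =>
    rw [Finset.sum_insert hi, Finset.sum_insert hi, ih, EReal.coe_add,
      EReal.coe_toReal (h' i) (h i)]

lemma aux_dom {n : ℕ} (ρ : Fin n → ℝ → EReal) (hb : ∀ i x, ρ i x ≠ ⊥)
    (hd : ∀ i, ∃ x, ρ i x ≠ ⊤)
    (hG : ∀ (σ : Equiv.Perm (Fin n)) (x : Fin n → ℝ), ∑ i, ρ i (x (σ i)) = ∑ i, ρ i (x i))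
    (i j : Fin n) (a : ℝ) (ha : ρ i a ≠ ⊤) : ρ j a ≠ ⊤ := by
  choose x0 hx0 using hd
  have h1 := hG (Equiv.swap i j) (Function.update x0 i a)
  have h2 : ∑ k, ρ k (Function.update x0 i a k) ≠ ⊤ := by
    rw [Ne, (aux_sum_top _ _ (fun k => hb k _)).2]
    rintro ⟨k, -, hk⟩
    by_cases hki : k = i
    · subst hki; simp at hk; exact ha hk
    · simp [hki] at hk; exact hx0 k hk
  rw [← h1, Ne, (aux_sum_top _ _ (fun k => hb k _)).2] at h2
  intro hj
  exact h2 ⟨j, Finset.mem_univ _, by simpa using hj⟩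

lemma aux_exch {n : ℕ} (ρ : Fin n → ℝ → EReal) (hb : ∀ i x, ρ i x ≠ ⊥)
    (hd : ∀ i, ∃ x, ρ i x ≠ ⊤)
    (hG : ∀ (σ : Equiv.Perm (Fin n)) (x : Fin n → ℝ), ∑ i, ρ i (x (σ i)) = ∑ i, ρ i (x i))
    (i j : Fin n) (a b : ℝ) (ha : ρ i a ≠ ⊤) (hbt : ρ i b ≠ ⊤) :
    (ρ i a).toReal - (ρ i b).toReal = (ρ j a).toReal - (ρ j b).toReal := by
  have key : ∀ m : Fin n, ∑ k, (ρ k (Function.update (fun _ => b) m a k)).toReal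
      = ∑ k, (ρ k b).toReal + ((ρ m a).toReal - (ρ m b).toReal) := by
    intro m
    rw [← sub_eq_iff_eq_add', ← Finset.sum_sub_distrib, Finset.sum_eq_single m]
    · simp
    · intro k _ hk; simp [hk]
    · simp
  have hfin : ∀ m k : Fin n, ρ k (Function.update (fun _ => b) m a k) ≠ ⊤ := by
    intro m k
    by_cases hk : k = m
    · subst hk; simpa using aux_dom ρ hb hd hG i k a ha
    · simpa [hk] using aux_dom ρ hb hd hG i k b hbt
  have h1 := hG (Equiv.swap i j) (Function.update (fun _ => b) i a)
  have h2 : ∀ k, Function.update (fun _ => b) i a (Equiv.swap i j k)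
      = Function.update (fun _ => b) j a k := by
    intro k
    simp only [Function.update_apply]
    have : (Equiv.swap i j k = i) ↔ k = j := by
      rw [Equiv.swap_apply_eq_iff]; simp
    simp [this]
  simp only [h2] at h1
  rw [aux_sum_coe _ _ (fun k => hb k _) (hfin j), aux_sum_coe _ _ (fun k => hb k _) (hfin i),
    EReal.coe_eq_coe_iff, key, key] at h1
  linarith

lemma aux_1d (γ : ℝ) (hγ : 0 < γ) (ρ : ℝ → EReal) (hρ : Gamma0 ρ)
    (hdom : ∃ x : ℝ, 0 ≤ x ∧ ρ x ≠ ⊤) (l p : ℝ)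
    (hp : ∀ x : ℝ, (γ : EReal) * ρ p + (((p - l) ^ 2 / 2 : ℝ) : EReal)
        ≤ (γ : EReal) * ρ x + (((x - l) ^ 2 / 2 : ℝ) : EReal))
    (hu : ∀ x : ℝ, (∀ x' : ℝ, (γ : EReal) * ρ x + (((x - l) ^ 2 / 2 : ℝ) : EReal)
        ≤ (γ : EReal) * ρ x' + (((x' - l) ^ 2 / 2 : ℝ) : EReal)) → x = p) :
    ρ (max 0 p) ≠ ⊤ ∧ ∀ x, 0 ≤ x → ρ x ≠ ⊤ → x ≠ max 0 p →
      γ * (ρ (max 0 p)).toReal + (max 0 p - l) ^ 2 / 2 < γ * (ρ x).toReal + (x - l) ^ 2 / 2 := by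
  have hb := hρ.1.2
  have hval : ∀ x, ρ x ≠ ⊤ → (γ : EReal) * ρ x + (((x - l) ^ 2 / 2 : ℝ) : EReal)
      = ((γ * (ρ x).toReal + (x - l) ^ 2 / 2 : ℝ) : EReal) := by
    intro x hx
    rw [EReal.coe_add, EReal.coe_mul, EReal.coe_toReal hx (hb x)]
  have htop : ∀ x, ρ x = ⊤ → (γ : EReal) * ρ x + (((x - l) ^ 2 / 2 : ℝ) : EReal) = ⊤ := by
    intro x hx
    rw [hx, EReal.coe_mul_top_of_pos hγ, EReal.top_add_coe]
  obtain ⟨x0, hx0, hx0t⟩ := hdom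
  have hpt : ρ p ≠ ⊤ := by
    intro h
    have := hp x0
    rw [htop p h, hval x0 hx0t] at this
    exact absurd this (not_le_of_gt (EReal.coe_lt_top _))
  have hlt : ∀ x, ρ x ≠ ⊤ → x ≠ p →
      γ * (ρ p).toReal + (p - l) ^ 2 / 2 < γ * (ρ x).toReal + (x - l) ^ 2 / 2 := by
    intro x hx hxp
    by_contra hcon
    push Not at hcon
    apply hxp
    apply hu
    intro x'
    refine le_trans ?_ (hp x')
    rw [hval x hx, hval p hpt]
    exact_mod_cast hcon
  rcases le_or_gt 0 p with h0 | h0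
  · rw [max_eq_right h0]
    exact ⟨hpt, fun x _ hx hne => hlt x hx hne⟩
  · rw [max_eq_left h0.le]
    -- convexity at zero
    have hcv : ∀ x, 0 ≤ x → ρ x ≠ ⊤ → ρ 0 ≠ ⊤ ∧
        (ρ 0).toReal ≤ (x / (x - p)) * (ρ p).toReal + (-p / (x - p)) * (ρ x).toReal := by
      intro x hx hxt
      have hpos : 0 < x - p := by linarith
      have hc := hρ.2.2 p x (x / (x - p)) (-p / (x - p)) (by positivity)
        (div_nonneg (by linarith) hpos.le) (by field_simp; ring)
      have hz : (x / (x - p)) • p + (-p / (x - p)) • x = 0 := by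
        simp only [smul_eq_mul]; field_simp; ring
      rw [hz, ← EReal.coe_toReal hpt (hb p), ← EReal.coe_toReal hxt (hb x), ← EReal.coe_mul,
        ← EReal.coe_mul, ← EReal.coe_add] at hc
      have h0t : ρ 0 ≠ ⊤ := fun h => by rw [h] at hc; exact absurd hc (not_le_of_gt (EReal.coe_lt_top _))
      refine ⟨h0t, ?_⟩
      rw [← EReal.coe_toReal h0t (hb 0)] at hc
      exact_mod_cast hc
    refine ⟨(hcv x0 hx0 hx0t).1, ?_⟩
    intro x hx hxt hne
    have hxpos : 0 < x := lt_of_le_of_ne hx (Ne.symm hne)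
    have hpos : 0 < x - p := by linarith
    have h1 := (hcv x hx hxt).2
    have h2 := hlt x hxt (by linarith)
    set a := x / (x - p) with ha
    set b := -p / (x - p) with hbdef
    have hapos : 0 < a := by positivity
    have hbpos : 0 < b := div_pos (by linarith) hpos
    have hab : a + b = 1 := by rw [ha, hbdef]; field_simp; ring
    have hz : a * p + b * x = 0 := by rw [ha, hbdef]; field_simp; ring
    have hbe : b = 1 - a := by linarith
    have h3 : γ * (ρ 0).toReal ≤ γ * (a * (ρ p).toReal + b * (ρ x).toReal) :=
      mul_le_mul_of_nonneg_left h1 hγ.le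
    have h4 : a * (γ * (ρ p).toReal + (p - l) ^ 2 / 2)
        < a * (γ * (ρ x).toReal + (x - l) ^ 2 / 2) := mul_lt_mul_of_pos_left h2 hapos
    have h5 : (0 - l) ^ 2 ≤ a * (p - l) ^ 2 + b * (x - l) ^ 2 := by
      have e : a * (p - l) ^ 2 + b * (x - l) ^ 2 - (0 - l) ^ 2
        = a * p ^ 2 + b * x ^ 2 - 2 * l * (a * p + b * x) + (a + b - 1) * l ^ 2 := by ring
      rw [hz, hab] at e
      have : 0 ≤ a * p ^ 2 + b * x ^ 2 := by positivity
      linarith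
    rw [hbe] at h3 h5
    nlinarith

lemma aux_frob_trace {n : ℕ} (A : Matrix (Fin n) (Fin n) ℝ) : frobSq A = (Aᵀ * A).trace := by
  unfold frobSq
  rw [Finset.sum_comm]
  simp [Matrix.trace, Matrix.mul_apply, pow_two]

lemma aux_frob_orth {n : ℕ} (U V A : Matrix (Fin n) (Fin n) ℝ) (hU : IsOrth U) (hV : IsOrth V) :
    frobSq (Uᵀ * A * V) = frobSq A := by
  have hU' : U * Uᵀ = 1 := mul_eq_one_comm.mp hU
  have hV' : V * Vᵀ = 1 := mul_eq_one_comm.mp hV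
  rw [aux_frob_trace, aux_frob_trace]
  have : (Uᵀ * A * V)ᵀ * (Uᵀ * A * V) = Vᵀ * (Aᵀ * (U * Uᵀ) * A * V) := by
    simp only [Matrix.transpose_mul, Matrix.transpose_transpose, Matrix.mul_assoc]
  rw [this, hU', Matrix.trace_mul_comm, Matrix.mul_assoc (_ * A), hV']
  simp

lemma aux_frob_dec {n : ℕ} (U V : Matrix (Fin n) (Fin n) ℝ) (d l : Fin n → ℝ)
    (hU : IsOrth U) (hV : IsOrth V) :
    frobSq (V * diagonal d * Vᵀ - U * diagonal l * Uᵀ)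
      = ∑ i, ∑ j, ((Uᵀ * V) i j) ^ 2 * (d j - l i) ^ 2 := by
  rw [← aux_frob_orth U V _ hU hV]
  have : Uᵀ * (V * diagonal d * Vᵀ - U * diagonal l * Uᵀ) * V
      = (Uᵀ * V) * diagonal d - diagonal l * (Uᵀ * V) := by
    have e : Uᵀ * (V * diagonal d * Vᵀ - U * diagonal l * Uᵀ) * V
      = (Uᵀ * V) * diagonal d * (Vᵀ * V) - (Uᵀ * U) * diagonal l * (Uᵀ * V) := by
      simp only [Matrix.mul_sub, Matrix.sub_mul, Matrix.mul_assoc]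
    rw [e, show Uᵀ * U = 1 from hU, show Vᵀ * V = 1 from hV]
    simp
  rw [this]
  unfold frobSq
  refine Finset.sum_congr rfl fun i _ => Finset.sum_congr rfl fun j _ => ?_
  rw [Matrix.sub_apply, Matrix.mul_diagonal, Matrix.diagonal_mul]
  ring

lemma aux_complete {n : ℕ} (C B T : Matrix (Fin n) (Fin n) ℝ) (hT : T.IsSymm) (γ : ℝ) :
    frobSq (C - B) / 2 - γ * (T * C).trace
      = frobSq (C - (B + γ • T)) / 2 - γ * (T * B).trace - γ ^ 2 / 2 * frobSq T := by
  have h : ∀ A : Matrix (Fin n) (Fin n) ℝ, (T * A).trace = ∑ i, ∑ j, T i j * A i j := by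
    intro A
    conv_lhs => rw [← hT.eq]
    rw [Finset.sum_comm]
    simp [Matrix.trace, Matrix.mul_apply]
  rw [h, h]
  unfold frobSq
  simp only [Finset.mul_sum, Finset.sum_div, ← Finset.sum_sub_distrib]
  refine Finset.sum_congr rfl fun i _ => Finset.sum_congr rfl fun j _ => ?_
  simp only [Matrix.sub_apply, Matrix.add_apply, Matrix.smul_apply, smul_eq_mul]
  ring

lemma aux_spec {n : ℕ} (C : Matrix (Fin n) (Fin n) ℝ) (hC : C.PosSemidef) :
    ∃ (V : Matrix (Fin n) (Fin n) ℝ) (d : Fin n → ℝ), IsOrth V ∧ C = V * diagonal d * Vᵀ ∧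
      ∀ i, 0 ≤ d i := by
  refine ⟨hC.1.eigenvectorUnitary, hC.1.eigenvalues, ?_, ?_, fun i => hC.eigenvalues_nonneg i⟩
  · have := (Unitary.mem_iff.mp hC.1.eigenvectorUnitary.2).1
    rw [Matrix.star_eq_conjTranspose, Matrix.conjTranspose_eq_transpose_of_trivial] at this
    exact this
  · have := hC.1.spectral_theorem
    rw [Unitary.conjStarAlgAut_apply, Matrix.star_eq_conjTranspose,
      Matrix.conjTranspose_eq_transpose_of_trivial] at this
    exact this

lemma aux_row {n : ℕ} (U V : Matrix (Fin n) (Fin n) ℝ) (hU : IsOrth U) (hV : IsOrth V) :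
    (∀ j, ∑ i, ((Uᵀ * V) i j) ^ 2 = 1) ∧ ∀ i, ∑ j, ((Uᵀ * V) i j) ^ 2 = 1 := by
  have hU' : U * Uᵀ = 1 := mul_eq_one_comm.mp hU
  have h1 : (Uᵀ * V)ᵀ * (Uᵀ * V) = 1 := by
    have : (Uᵀ * V)ᵀ * (Uᵀ * V) = Vᵀ * ((U * Uᵀ) * V) := by
      simp only [Matrix.transpose_mul, Matrix.transpose_transpose, Matrix.mul_assoc]
    rw [this, hU', Matrix.one_mul]; exact hV
  have h2 : (Uᵀ * V) * (Uᵀ * V)ᵀ = 1 := mul_eq_one_comm.mp h1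
  constructor
  · intro j
    have := congrFun (congrFun h1 j) j
    rw [Matrix.mul_apply] at this
    simpa [pow_two] using this
  · intro i
    have := congrFun (congrFun h2 i) i
    rw [Matrix.mul_apply] at this
    simpa [pow_two] using this

/-- Weighted comparison. -/
lemma aux_cmp {n : ℕ} (W : Matrix (Fin n) (Fin n) ℝ) (hc : ∀ j, ∑ i, (W i j) ^ 2 = 1)
    (hr : ∀ i, ∑ j, (W i j) ^ 2 = 1) (r : ℝ → ℝ) (γ : ℝ) (d q l : Fin n → ℝ)
    (h : ∀ i j, d j ≠ q i →
      γ * r (q i) + (q i - l i) ^ 2 / 2 < γ * r (d j) + (d j - l i) ^ 2 / 2) :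
    ((∑ i, (γ * r (q i) + (q i - l i) ^ 2 / 2)) ≤
      ∑ j, γ * r (d j) + (∑ i, ∑ j, (W i j) ^ 2 * (d j - l i) ^ 2) / 2) ∧
    ((∑ i, (γ * r (q i) + (q i - l i) ^ 2 / 2)) =
      ∑ j, γ * r (d j) + (∑ i, ∑ j, (W i j) ^ 2 * (d j - l i) ^ 2) / 2 →
      ∀ i j, W i j * d j = q i * W i j) := by
  have hle : ∀ i j, 0 ≤ (W i j) ^ 2 * ((γ * r (d j) + (d j - l i) ^ 2 / 2) -
      (γ * r (q i) + (q i - l i) ^ 2 / 2)) := by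
    intro i j
    refine mul_nonneg (sq_nonneg _) ?_
    by_cases he : d j = q i
    · rw [he]; simp
    · linarith [h i j he]
  have hdiff : ∑ j, γ * r (d j) + (∑ i, ∑ j, (W i j) ^ 2 * (d j - l i) ^ 2) / 2
      - (∑ i, (γ * r (q i) + (q i - l i) ^ 2 / 2))
      = ∑ i, ∑ j, (W i j) ^ 2 * ((γ * r (d j) + (d j - l i) ^ 2 / 2) -
      (γ * r (q i) + (q i - l i) ^ 2 / 2)) := by
    have e1 : ∑ j, γ * r (d j) = ∑ i, ∑ j, (W i j) ^ 2 * (γ * r (d j)) := by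
      rw [Finset.sum_comm]
      refine Finset.sum_congr rfl fun j _ => ?_
      rw [← Finset.sum_mul, hc, one_mul]
    have e2 : (∑ i, (γ * r (q i) + (q i - l i) ^ 2 / 2))
        = ∑ i, ∑ j, (W i j) ^ 2 * (γ * r (q i) + (q i - l i) ^ 2 / 2) := by
      refine Finset.sum_congr rfl fun j _ => ?_
      rw [← Finset.sum_mul, hr, one_mul]
    rw [e1, e2]
    simp only [Finset.sum_div, ← Finset.sum_sub_distrib, ← Finset.sum_add_distrib]
    refine Finset.sum_congr rfl fun i _ => Finset.sum_congr rfl fun j _ => ?_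
    ring
  constructor
  · have : 0 ≤ ∑ i, ∑ j, (W i j) ^ 2 * ((γ * r (d j) + (d j - l i) ^ 2 / 2) -
      (γ * r (q i) + (q i - l i) ^ 2 / 2)) :=
      Finset.sum_nonneg fun i _ => Finset.sum_nonneg fun j _ => hle i j
    linarith
  · intro heq i j
    rw [heq, sub_self] at hdiff
    have h1 := (Finset.sum_eq_zero_iff_of_nonneg
      (fun i _ => Finset.sum_nonneg fun j _ => hle i j)).mp hdiff.symm i (Finset.mem_univ _)
    have h2 := (Finset.sum_eq_zero_iff_of_nonneg (fun j _ => hle i j)).mp h1 j (Finset.mem_univ _)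
    rcases mul_eq_zero.mp h2 with h3 | h3
    · have : W i j = 0 := by simpa using h3
      rw [this]; simp
    · have : d j = q i := by
        by_contra hne
        linarith [h i j hne]
      rw [this]; ring

lemma aux_eval {n : ℕ} (γ : ℝ) (hγ : 0 < γ) (a b : EReal) (ha : a ≠ ⊥) (hb : b ≠ ⊥)
    (ρ : Fin n → EReal) (hρ : ∀ i, ρ i ≠ ⊥) (hab : a + b = ∑ i, ρ i) (t F : ℝ) :
    ((∃ i, ρ i = ⊤) → (γ : EReal) * (a - (t : EReal) + b) + (F : EReal) = ⊤) ∧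
    ((∀ i, ρ i ≠ ⊤) → (γ : EReal) * (a - (t : EReal) + b) + (F : EReal)
      = ((γ * ∑ i, (ρ i).toReal + (F - γ * t) : ℝ) : EReal)) := by
  have e : a - (t : EReal) + b = (∑ i, ρ i) - (t : EReal) := by
    rw [← hab, sub_eq_add_neg, sub_eq_add_neg, add_right_comm]
  rw [e]
  constructor
  · rintro ⟨i, hi⟩
    rw [(aux_sum_top _ _ hρ).2.mpr ⟨i, Finset.mem_univ _, hi⟩, EReal.top_sub_coe,
      EReal.coe_mul_top_of_pos hγ, EReal.top_add_coe]
  · intro h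
    rw [aux_sum_coe _ _ hρ h, ← EReal.coe_sub, ← EReal.coe_mul, ← EReal.coe_add]
    congr 1
    ring


/-- Proposition 2 of the paper: proximity operator with a positive semidefinite
constraint. Here `p i = prox_{γρᵢ}(λᵢ)` and the conclusion states that
`U Diag(max(0, p i)) Uᵀ` is the unique minimizer over symmetric matrices of
`C ↦ γ(f(C) − tr(TC) + g₀(C)) + ½‖C − C̄‖_F²` restricted to positive semidefinite matrices
(the objective being `+∞` off the PSD cone). -/
theorem stmt6 (n : ℕ) (hn : 0 < n) (γ : ℝ) (hγ : 0 < γ)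
    (Cbar T : Matrix (Fin n) (Fin n) ℝ) (hCbar : Cbar.IsSymm) (hT : T.IsSymm)
    (f g₀ : Matrix (Fin n) (Fin n) ℝ → EReal) (φ ψ : (Fin n → ℝ) → EReal)
    (hφ : Gamma0 φ) (hψ : Gamma0 ψ)
    (hf : IsSpectral f φ) (hg : IsSpectral g₀ ψ)
    (ρ : Fin n → ℝ → EReal) (hρ : ∀ i, Gamma0 (ρ i))
    (hρdom : ∀ i, ∃ x : ℝ, 0 ≤ x ∧ ρ i x ≠ ⊤)
    (hsum : ∀ x : Fin n → ℝ, φ x + ψ x = ∑ i, ρ i (x i))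
    (lam : Fin n → ℝ) (U : Matrix (Fin n) (Fin n) ℝ) (hU : IsOrth U)
    (hdec : Cbar + γ • T = U * Matrix.diagonal lam * Uᵀ)
    (p : Fin n → ℝ)
    (hp : ∀ i, ∀ x : ℝ,
      (γ : EReal) * ρ i (p i) + (((p i - lam i) ^ 2 / 2 : ℝ) : EReal)
        ≤ (γ : EReal) * ρ i x + (((x - lam i) ^ 2 / 2 : ℝ) : EReal))
    (hpuniq : ∀ i, ∀ x : ℝ,
      (∀ x' : ℝ, (γ : EReal) * ρ i x + (((x - lam i) ^ 2 / 2 : ℝ) : EReal)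
        ≤ (γ : EReal) * ρ i x' + (((x' - lam i) ^ 2 / 2 : ℝ) : EReal)) → x = p i) :
    (U * Matrix.diagonal (fun i => max 0 (p i)) * Uᵀ).IsSymm ∧
    (∀ C : Matrix (Fin n) (Fin n) ℝ, C.IsSymm →
      (if (U * Matrix.diagonal (fun i => max 0 (p i)) * Uᵀ).PosSemidef then
          (γ : EReal) * (f (U * Matrix.diagonal (fun i => max 0 (p i)) * Uᵀ)
              - (((T * (U * Matrix.diagonal (fun i => max 0 (p i)) * Uᵀ)).trace : ℝ) : EReal)
              + g₀ (U * Matrix.diagonal (fun i => max 0 (p i)) * Uᵀ))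
            + ((frobSq (U * Matrix.diagonal (fun i => max 0 (p i)) * Uᵀ - Cbar) / 2 : ℝ) : EReal)
        else ⊤)
        ≤ (if C.PosSemidef then
            (γ : EReal) * (f C - (((T * C).trace : ℝ) : EReal) + g₀ C)
              + ((frobSq (C - Cbar) / 2 : ℝ) : EReal)
          else ⊤)) ∧
    (∀ C : Matrix (Fin n) (Fin n) ℝ, C.IsSymm →
      (∀ C' : Matrix (Fin n) (Fin n) ℝ, C'.IsSymm →
        (if C.PosSemidef then
            (γ : EReal) * (f C - (((T * C).trace : ℝ) : EReal) + g₀ C)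
              + ((frobSq (C - Cbar) / 2 : ℝ) : EReal)
          else ⊤)
          ≤ (if C'.PosSemidef then
              (γ : EReal) * (f C' - (((T * C').trace : ℝ) : EReal) + g₀ C')
                + ((frobSq (C' - Cbar) / 2 : ℝ) : EReal)
            else ⊤)) →
      C = U * Matrix.diagonal (fun i => max 0 (p i)) * Uᵀ) := by
  have hb : ∀ i x, ρ i x ≠ ⊥ := fun i => (hρ i).1.2
  have hd : ∀ i, ∃ x, ρ i x ≠ ⊤ := fun i => (hρ i).1.1
  have hG : ∀ (σ : Equiv.Perm (Fin n)) (x : Fin n → ℝ),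
      ∑ i, ρ i (x (σ i)) = ∑ i, ρ i (x i) := by
    intro σ x
    rw [← hsum x, ← hf.1 σ x, ← hg.1 σ x, hsum]
    rfl
  have hq := fun i => aux_1d γ hγ (ρ i) (hρ i) (hρdom i) (lam i) (p i) (hp i) (hpuniq i)
  set q : Fin n → ℝ := fun i => max 0 (p i) with hqdef
  set Q := U * Matrix.diagonal q * Uᵀ with hQ
  have hQs : Q.IsSymm := by
    rw [hQ, Matrix.IsSymm]
    simp [Matrix.transpose_mul, Matrix.mul_assoc]
  have hQp : Q.PosSemidef := by
    have h1 : (Matrix.diagonal q).PosSemidef :=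
      Matrix.PosSemidef.diagonal (fun i => le_max_left 0 (p i))
    have := h1.mul_mul_conjTranspose_same U
    rwa [Matrix.conjTranspose_eq_transpose_of_trivial] at this
  let J : Matrix (Fin n) (Fin n) ℝ → EReal := fun C =>
    (γ : EReal) * (f C - (((T * C).trace : ℝ) : EReal) + g₀ C)
              + ((frobSq (C - Cbar) / 2 : ℝ) : EReal)
  let i0 : Fin n := ⟨0, hn⟩
  let r : ℝ → ℝ := fun x => (ρ i0 x).toReal
  let c : Fin n → ℝ := fun i => (ρ i (q i0)).toReal - (ρ i0 (q i0)).toReal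
  have hrc : ∀ i x, ρ i x ≠ ⊤ → (ρ i x).toReal = r x + c i := by
    intro i x hx
    have := aux_exch ρ hb hd hG i i0 x (q i0) hx (aux_dom ρ hb hd hG i0 i _ (hq i0).1)
    simp only [r, c]
    linarith
  let K : ℝ := γ * ∑ i, c i - γ * (T * Cbar).trace - γ ^ 2 / 2 * frobSq T
  have hJ : ∀ (V : Matrix (Fin n) (Fin n) ℝ) (d : Fin n → ℝ), IsOrth V →
      ((∃ i, ρ i (d i) = ⊤) → J (V * diagonal d * Vᵀ) = ⊤) ∧
      ((∀ i, ρ i (d i) ≠ ⊤) → J (V * diagonal d * Vᵀ) =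
        ((∑ j, γ * r (d j) + (∑ i, ∑ j, ((Uᵀ * V) i j) ^ 2 * (d j - lam i) ^ 2) / 2 + K : ℝ)
          : EReal)) := by
    intro V d hV
    have h1 := aux_eval γ hγ (φ d) (ψ d) (hφ.1.2 d) (hψ.1.2 d) (fun i => ρ i (d i))
      (fun i => hb i _) (hsum d) (T * (V * diagonal d * Vᵀ)).trace
      (frobSq (V * diagonal d * Vᵀ - Cbar) / 2)
    simp only [J]
    rw [hf.2 _ d ⟨V, hV, rfl⟩, hg.2 _ d ⟨V, hV, rfl⟩]
    refine ⟨h1.1, fun h => ?_⟩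
    rw [h1.2 h, aux_complete _ _ _ hT, hdec, aux_frob_dec U V d lam hU hV]
    congr 1
    rw [Finset.sum_congr rfl (fun i _ => hrc i (d i) (h i)), Finset.sum_add_distrib,
      ← Finset.mul_sum]
    simp only [K]
    ring
  have hJQ : J Q = ((∑ i, (γ * r (q i) + (q i - lam i) ^ 2 / 2) + K : ℝ) : EReal) := by
    rw [hQ, (hJ U q hU).2 (fun i => (hq i).1)]
    congr 1
    rw [show Uᵀ * U = 1 from hU, Finset.sum_add_distrib, Finset.sum_div]
    congr 2
    refine Finset.sum_congr rfl fun i _ => ?_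
    rw [Finset.sum_eq_single i]
    · simp
    · intro j _ hj; simp [Matrix.one_apply, Ne.symm hj]
    · simp
  have main : ∀ C : Matrix (Fin n) (Fin n) ℝ, C.PosSemidef →
      J Q ≤ J C ∧ (J C ≤ J Q → C = Q) := by
    intro C hC
    obtain ⟨V, d, hV, rfl, hd0⟩ := aux_spec C hC
    by_cases ht : ∃ i, ρ i (d i) = ⊤
    · rw [(hJ V d hV).1 ht, hJQ]
      exact ⟨le_top, fun h => absurd h (not_le_of_gt (EReal.coe_lt_top _))⟩
    · push Not at ht
      have hcr := aux_row U V hU hV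
      have hcmp := aux_cmp (Uᵀ * V) hcr.1 hcr.2 r γ d q lam (by
        intro i j hne
        have hij : ρ i (d j) ≠ ⊤ := aux_dom ρ hb hd hG j i _ (ht j)
        have := (hq i).2 (d j) (hd0 j) hij hne
        rw [hrc i _ hij, hrc i _ (hq i).1] at this
        simp only [hqdef] at *
        linarith)
      rw [(hJ V d hV).2 ht, hJQ, EReal.coe_le_coe_iff, EReal.coe_le_coe_iff]
      refine ⟨by linarith [hcmp.1], fun h => ?_⟩
      have hW := hcmp.2 (le_antisymm hcmp.1 (by linarith))
      have hW' : (Uᵀ * V) * diagonal d = diagonal q * (Uᵀ * V) := by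
        ext i j
        rw [Matrix.mul_diagonal, Matrix.diagonal_mul]
        exact hW i j
      have hU' : U * Uᵀ = 1 := mul_eq_one_comm.mp hU
      have hV' : V * Vᵀ = 1 := mul_eq_one_comm.mp hV
      calc V * diagonal d * Vᵀ = (U * Uᵀ) * V * diagonal d * Vᵀ := by rw [hU', Matrix.one_mul]
        _ = U * ((Uᵀ * V) * diagonal d) * Vᵀ := by simp only [Matrix.mul_assoc]
        _ = U * (diagonal q * (Uᵀ * V)) * Vᵀ := by rw [hW']
        _ = U * diagonal q * Uᵀ * (V * Vᵀ) := by simp only [Matrix.mul_assoc]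
        _ = Q := by rw [hV', Matrix.mul_one]
  refine ⟨hQs, ?_, ?_⟩
  · intro C _
    rw [if_pos hQp]
    split_ifs with hC
    · exact (main C hC).1
    · exact le_top
  · intro C _ hmin
    have h1 := hmin Q hQs
    rw [if_pos hQp] at h1
    split_ifs at h1 with hC
    · exact (main C hC).2 h1
    · exfalso
      change ⊤ ≤ J Q at h1
      rw [hJQ] at h1
      exact absurd h1 (not_le_of_gt (EReal.coe_lt_top _))
end
end
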